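/- Let V = ℂ² with a nondegenerate symmetric bilinear form Φ and orthonormal basis e₁, e₂ (Φ(e_i, e_j) = δ_{ij}), and in the Clifford algebra Cl(V) set ψ₁ = (e₁ + i e₂)/2 and ψ₁† = (e₁ − i e₂)/2. Then the map f : ℂˣ → Cl(V) defined by f(t) = t·1 + (t⁻¹ − t)·ψ₁†ψ₁ is an injective group homomorphism into the group of units of Cl(V) whose image is exactly Spin(V); i.e., f(s)f(t) = f(st) for all s, t ∈ ℂˣ, each f(t) lies in Spin(V), f is injective, and every element of Spin(V) equals f(t) for some t ∈ ℂˣ. In particular Spin(V) ≅ ℂˣ when dim V = 2. -/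

import Mathlib

open CliffordAlgebra

noncomputable section

/-- The Pin group of a quadratic form `Q`, following the paper: invertible homogeneous
elements `g` of the Clifford algebra such that conjugation by `g` preserves `V ⊆ Cl(V)`
and with spinor norm `g · ι(g) = 1`, where `ι` is the reversal antiautomorphism. -/
def PinSet {V : Type*} [AddCommGroup V] [Module ℂ V] (Q : QuadraticForm ℂ V) :
    Set (CliffordAlgebra Q) :=
  {g | IsUnit g ∧ (∃ i : ZMod 2, g ∈ evenOdd Q i) ∧
    ((fun x => g * x * Ring.inverse g) '' Set.range (ι Q) = Set.range (ι Q)) ∧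
    g * CliffordAlgebra.reverse g = 1}

/-- The Spin group: the intersection of the Pin group with the even part of the
Clifford algebra. -/
def SpinSet {V : Type*} [AddCommGroup V] [Module ℂ V] (Q : QuadraticForm ℂ V) :
    Set (CliffordAlgebra Q) :=
  {g | g ∈ PinSet Q ∧ g ∈ evenOdd Q 0}

/-- The standard symmetric bilinear form on `V = ℂ²`, for which `e₁, e₂` is an
orthonormal basis. -/
def stdBilin2 : LinearMap.BilinForm ℂ (Fin 2 → ℂ) :=
  LinearMap.mk₂ ℂ (fun u v => u 0 * v 0 + u 1 * v 1)
    (by intros; simp only [Pi.add_apply]; ring)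
    (by intros; simp only [Pi.smul_apply, smul_eq_mul]; ring)
    (by intros; simp only [Pi.add_apply]; ring)
    (by intros; simp only [Pi.smul_apply, smul_eq_mul]; ring)

/-- The associated quadratic form on `ℂ²`. -/
def Q2 : QuadraticForm ℂ (Fin 2 → ℂ) := LinearMap.BilinMap.toQuadraticMap stdBilin2

/-- The first standard basis vector `e₁` of `ℂ²`. -/
def e1 : Fin 2 → ℂ := Pi.single 0 1

/-- The second standard basis vector `e₂` of `ℂ²`. -/
def e2 : Fin 2 → ℂ := Pi.single 1 1

/-- The element `ψ₁ = (e₁ + i e₂)/2` of the Clifford algebra of `ℂ²`. -/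
def psi1 : CliffordAlgebra Q2 :=
  ι Q2 ((2⁻¹ : ℂ) • (e1 + Complex.I • e2))

/-- The element `ψ₁† = (e₁ − i e₂)/2` of the Clifford algebra of `ℂ²`. -/
def psi1d : CliffordAlgebra Q2 :=
  ι Q2 ((2⁻¹ : ℂ) • (e1 - Complex.I • e2))

/-- The map `f : ℂˣ → Cl(V)`, `f(t) = t·1 + (t⁻¹ − t)·ψ₁†ψ₁`. -/
def fSpin (t : ℂˣ) : CliffordAlgebra Q2 :=
  algebraMap ℂ (CliffordAlgebra Q2) (t : ℂ) + (((t⁻¹ : ℂˣ) : ℂ) - (t : ℂ)) • (psi1d * psi1)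

def pp : CliffordAlgebra Q2 := psi1d * psi1
def qq : CliffordAlgebra Q2 := psi1 * psi1d

lemma Q2_apply (v : Fin 2 → ℂ) : Q2 v = v 0 * v 0 + v 1 * v 1 := rfl

lemma aa : psi1 * psi1 = 0 := by
  rw [psi1, ι_sq_scalar, Q2_apply]
  have : ((2⁻¹ : ℂ) • (e1 + Complex.I • e2)) 0 * ((2⁻¹ : ℂ) • (e1 + Complex.I • e2)) 0 +
    ((2⁻¹ : ℂ) • (e1 + Complex.I • e2)) 1 * ((2⁻¹ : ℂ) • (e1 + Complex.I • e2)) 1 = 0 := by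
    simp [e1, e2]
    linear_combination (1/4 : ℂ) * Complex.I_mul_I
  rw [this, map_zero]

lemma bb : psi1d * psi1d = 0 := by
  rw [psi1d, ι_sq_scalar, Q2_apply]
  have : ((2⁻¹ : ℂ) • (e1 - Complex.I • e2)) 0 * ((2⁻¹ : ℂ) • (e1 - Complex.I • e2)) 0 +
    ((2⁻¹ : ℂ) • (e1 - Complex.I • e2)) 1 * ((2⁻¹ : ℂ) • (e1 - Complex.I • e2)) 1 = 0 := by
    simp [e1, e2]
    linear_combination (1/4 : ℂ) * Complex.I_mul_I
  rw [this, map_zero]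

lemma q_add_p : qq + pp = 1 := by
  rw [qq, pp, psi1d, psi1, ι_mul_ι_add_swap, QuadraticMap.polar, Q2_apply, Q2_apply, Q2_apply,
    ← map_one (algebraMap ℂ (CliffordAlgebra Q2))]
  congr 1
  simp [e1, e2]
  linear_combination (-1/2 : ℂ) * Complex.I_mul_I

lemma qa : qq * psi1 = psi1 := by
  have h := congrArg (· * psi1) q_add_p
  simpa [add_mul, pp, mul_assoc, aa] using h
lemma pb : pp * psi1d = psi1d := by
  have h := congrArg (· * psi1d) q_add_p
  simpa [add_mul, qq, mul_assoc, bb] using h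
lemma ap : psi1 * pp = psi1 := by rw [pp, ← mul_assoc]; exact qa
lemma bq : psi1d * qq = psi1d := by rw [qq, ← mul_assoc]; exact pb
lemma pa : pp * psi1 = 0 := by rw [pp, mul_assoc, aa, mul_zero]
lemma qb : qq * psi1d = 0 := by rw [qq, mul_assoc, bb, mul_zero]
lemma aq : psi1 * qq = 0 := by rw [qq, ← mul_assoc, aa, zero_mul]
lemma bp : psi1d * pp = 0 := by rw [pp, ← mul_assoc, bb, zero_mul]
lemma p_p : pp * pp = pp := by
  conv_lhs => rw [pp, mul_assoc, ← pp, ap]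
  rfl
lemma q_q : qq * qq = qq := by
  conv_lhs => rw [qq, mul_assoc, ← qq, bq]
  rfl
lemma p_q : pp * qq = 0 := by rw [pp, mul_assoc, aq, mul_zero]
lemma q_p : qq * pp = 0 := by rw [qq, mul_assoc, bp, mul_zero]

lemma rev_p : CliffordAlgebra.reverse pp = qq := by
  rw [pp, qq, reverse.map_mul, psi1, psi1d, reverse_ι, reverse_ι]
lemma rev_q : CliffordAlgebra.reverse qq = pp := by
  rw [pp, qq, reverse.map_mul, psi1, psi1d, reverse_ι, reverse_ι]

lemma alg_eq (c : ℂ) : algebraMap ℂ (CliffordAlgebra Q2) c = c • qq + c • pp := by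
  rw [Algebra.algebraMap_eq_smul_one, ← q_add_p, smul_add]

lemma f_eq (t : ℂˣ) : fSpin t = (t : ℂ) • qq + ((t⁻¹ : ℂˣ) : ℂ) • pp := by
  rw [fSpin, alg_eq, ← pp]; module

lemma ι_eq (v : Fin 2 → ℂ) :
    ι Q2 v = (v 0 - Complex.I * v 1) • psi1 + (v 0 + Complex.I * v 1) • psi1d := by
  rw [psi1, psi1d, ← map_smul, ← map_smul, ← map_add]
  congr 1
  ext i
  fin_cases i
  · simp [e1, e2]; ring
  · simp [e1, e2]; linear_combination (v 1) * Complex.I_mul_I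

lemma mem_range (x y : ℂ) : x • psi1 + y • psi1d ∈ Set.range (ι Q2) :=
  (LinearMap.range (ι Q2)).add_mem
    ((LinearMap.range (ι Q2)).smul_mem x ⟨_, rfl⟩) ((LinearMap.range (ι Q2)).smul_mem y ⟨_, rfl⟩)

lemma q_ne : qq ≠ 0 := by
  intro h
  have h2 := rev_q
  rw [h, map_zero] at h2
  have := q_add_p
  rw [h, ← h2, add_zero] at this
  exact zero_ne_one this

lemma f_mul (s t : ℂˣ) : fSpin s * fSpin t = fSpin (s * t) := by
  simp only [f_eq, mul_add, add_mul, smul_mul_assoc, mul_smul_comm, p_p, q_q, p_q, q_p,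
    mul_inv, Units.val_mul]
  module

lemma f_one : fSpin 1 = 1 := by
  simp [f_eq, q_add_p]

lemma f_unit (t : ℂˣ) : IsUnit (fSpin t) :=
  ⟨⟨fSpin t, fSpin t⁻¹, by rw [f_mul]; simp [f_one], by rw [f_mul]; simp [f_one]⟩, rfl⟩

lemma f_inv (t : ℂˣ) : Ring.inverse (fSpin t) = fSpin t⁻¹ := by
  have h : fSpin t⁻¹ * fSpin t = 1 := by rw [f_mul]; simp [f_one]
  rw [← mul_one (fSpin t⁻¹), ← Ring.mul_inverse_cancel _ (f_unit t), ← mul_assoc, h, one_mul]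

lemma f_conj (t : ℂˣ) (v : Fin 2 → ℂ) :
    fSpin t * ι Q2 v * fSpin t⁻¹ ∈ Set.range (ι Q2) := by
  rw [ι_eq]
  convert mem_range ((t : ℂ) * t * (v 0 - Complex.I * v 1))
    (((t⁻¹ : ℂˣ) : ℂ) * ((t⁻¹ : ℂˣ) : ℂ) * (v 0 + Complex.I * v 1)) using 1
  simp only [f_eq, mul_add, add_mul, smul_mul_assoc, mul_smul_comm, qa, pb, ap, bq, pa, qb, aq, bp,
    inv_inv, smul_zero, add_zero, zero_add, smul_smul]
  module

lemma f_even (t : ℂˣ) : fSpin t ∈ evenOdd Q2 0 := by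
  rw [fSpin]
  refine add_mem ?_ (Submodule.smul_mem _ _ ?_)
  · exact SetLike.algebraMap_mem_graded (evenOdd Q2) _
  · exact ι_mul_ι_mem_evenOdd_zero Q2 _ _

lemma even_form (g : CliffordAlgebra Q2) (hg : g ∈ evenOdd Q2 0) :
    ∃ x y : ℂ, g = x • qq + y • pp := by
  induction g, hg using CliffordAlgebra.even_induction with
  | algebraMap r => exact ⟨r, r, alg_eq r⟩
  | add x y hx hy ihx ihy =>
    obtain ⟨a, b, rfl⟩ := ihx
    obtain ⟨c, d, rfl⟩ := ihy
    exact ⟨a + c, b + d, by module⟩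
  | ι_mul_ι_mul m₁ m₂ x hx ih =>
    obtain ⟨a, b, rfl⟩ := ih
    refine ⟨(m₁ 0 - Complex.I * m₁ 1) * (m₂ 0 + Complex.I * m₂ 1) * a,
      (m₁ 0 + Complex.I * m₁ 1) * (m₂ 0 - Complex.I * m₂ 1) * b, ?_⟩
    have h1 : psi1 * psi1d = qq := rfl
    have h2 : psi1d * psi1 = pp := rfl
    rw [ι_eq m₁, ι_eq m₂]
    simp only [mul_add, add_mul, smul_mul_assoc, mul_smul_comm, aa, bb, h1, h2, p_p, q_q, p_q, q_p,
      smul_zero, add_zero, zero_add, smul_smul]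
    module

lemma mul_rev (x y : ℂ) :
    (x • qq + y • pp) * CliffordAlgebra.reverse (x • qq + y • pp) =
      algebraMap ℂ (CliffordAlgebra Q2) (x * y) := by
  rw [map_add, map_smul, map_smul, rev_p, rev_q, alg_eq]
  simp only [mul_add, add_mul, smul_mul_assoc, mul_smul_comm, p_p, q_q, p_q, q_p]
  module

/-- For `dim V = 2`, the map `t ↦ t + (t⁻¹ − t)ψ₁†ψ₁` is an injective group homomorphism
from `ℂˣ` onto `Spin(V)`; in particular `Spin(V) ≅ ℂˣ`. -/
theorem statement19 :
    (∀ s t : ℂˣ, fSpin s * fSpin t = fSpin (s * t)) ∧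
    (∀ t : ℂˣ, fSpin t ∈ SpinSet Q2) ∧
    Function.Injective fSpin ∧
    (∀ g ∈ SpinSet Q2, ∃ t : ℂˣ, g = fSpin t) := by
  refine ⟨f_mul, fun t => ⟨⟨f_unit t, ⟨0, f_even t⟩, ?_, ?_⟩, f_even t⟩, ?_, ?_⟩
  · apply Set.Subset.antisymm
    · rintro _ ⟨_, ⟨v, rfl⟩, rfl⟩
      simp only [f_inv]
      exact f_conj t v
    · rintro _ ⟨v, rfl⟩
      refine ⟨fSpin t⁻¹ * ι Q2 v * fSpin t, ?_, ?_⟩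
      · simpa using f_conj t⁻¹ v
      · have h : fSpin t * fSpin t⁻¹ = 1 := by rw [f_mul]; simp [f_one]
        simp only [f_inv]
        rw [mul_assoc, mul_assoc, mul_assoc, h, mul_one, ← mul_assoc, h, one_mul]
  · rw [f_eq, mul_rev]; simp
  · intro s t h
    have h2 := congrArg (· * qq) h
    simp only [f_eq, add_mul, smul_mul_assoc, q_q, p_q, smul_zero, add_zero] at h2
    exact Units.ext (smul_left_injective ℂ q_ne h2)
  · rintro g ⟨⟨-, -, -, h⟩, hg⟩
    obtain ⟨x, y, rfl⟩ := even_form g hg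
    rw [mul_rev, ← map_one (algebraMap ℂ (CliffordAlgebra Q2))] at h
    have hxy : x * y = 1 := (algebraMap ℂ (CliffordAlgebra Q2)).injective h
    refine ⟨⟨x, y, hxy, by rw [mul_comm, hxy]⟩, ?_⟩
    rw [f_eq]; rfl


end
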